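/- Let S be an n×k complex matrix with S†S = I_k and let α ∈ [1/2, 1). Then the function Ψ_{α,S}(G, Z) := Tr[(G^{1/2} S† Z^{(1−α)/α} S G^{1/2})^α] is jointly concave on pairs of positive definite Hermitian matrices: for all k×k positive definite Hermitian G₀, G₁, all n×n positive definite Hermitian Z₀, Z₁, and all λ ∈ [0,1], Ψ_{α,S}(λG₀+(1−λ)G₁, λZ₀+(1−λ)Z₁) ≥ λΨ_{α,S}(G₀,Z₀) + (1−λ)Ψ_{α,S}(G₁,Z₁). -/

import Mathlib

open Matrix
open scoped ComplexOrder

/-- The real power of a matrix, taken via the continuous functional calculus applied to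
`x ↦ x ^ p` (real `rpow`). -/
noncomputable def mpow {n : ℕ} (A : Matrix (Fin n) (Fin n) ℂ) (p : ℝ) :
    Matrix (Fin n) (Fin n) ℂ :=
  cfc (fun x : ℝ => x ^ p) A

/-- `Ψ_{α,S}(G, Z) := Tr[(G^{1/2} Sᴴ Z^{(1−α)/α} S G^{1/2})^α]` (real-valued). -/
noncomputable def PsiS {n k : ℕ} (α : ℝ) (S : Matrix (Fin n) (Fin k) ℂ)
    (G : Matrix (Fin k) (Fin k) ℂ) (Z : Matrix (Fin n) (Fin n) ℂ) : ℝ :=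
  ((mpow (mpow G (1 / 2) * Sᴴ * mpow Z ((1 - α) / α) * S * mpow G (1 / 2)) α).trace).re

lemma posDef_convexCombination {m : Type*} {A B : Matrix m m ℂ} (hA : A.PosDef)
    (hB : B.PosDef) {l : ℝ} (hl0 : 0 ≤ l) (hl1 : l ≤ 1) : (l • A + (1 - l) • B).PosDef := by
  rcases hl0.eq_or_lt with rfl | h0
  · simpa using hB
  · exact (hA.smul h0).add_posSemidef (hB.posSemidef.smul (sub_nonneg.2 hl1))

lemma re_trace_mul_convexCombination_mul {m n : Type*} [Fintype m] [Fintype n] (l : ℝ)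
    (C : Matrix n m ℂ) (A B : Matrix m m ℂ) (D : Matrix m n ℂ) :
    (C * (l • A + (1 - l) • B) * D).trace.re =
      l * (C * A * D).trace.re + (1 - l) * (C * B * D).trace.re := by
  simp [Matrix.mul_add, Matrix.add_mul]

section SpectralSums

variable {m n : Type*} [Fintype m] [DecidableEq m] [Fintype n] [DecidableEq n]

/-- The squared moduli of the entries of `C` in eigenbases of the Hermitian matrices `A`, `B`. -/
noncomputable def spectralWeight {A : Matrix m m ℂ} {B : Matrix n n ℂ} (hA : A.IsHermitian)
    (hB : B.IsHermitian) (C : Matrix m n ℂ) (i : m) (j : n) : ℝ :=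
  ‖((hA.eigenvectorUnitary : Matrix m m ℂ)ᴴ * C * (hB.eigenvectorUnitary : Matrix n n ℂ)) i j‖ ^ 2

lemma spectralWeight_nonneg {A : Matrix m m ℂ} {B : Matrix n n ℂ} (hA : A.IsHermitian)
    (hB : B.IsHermitian) (C : Matrix m n ℂ) (i : m) (j : n) : 0 ≤ spectralWeight hA hB C i j := by
  unfold spectralWeight
  positivity

lemma cfc_eq_mul_diagonal_mul {A : Matrix m m ℂ} (hA : A.IsHermitian) (f : ℝ → ℝ) :
    cfc f A = (hA.eigenvectorUnitary : Matrix m m ℂ) *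
      diagonal (fun i => (f (hA.eigenvalues i) : ℂ)) * (hA.eigenvectorUnitary : Matrix m m ℂ)ᴴ := by
  rw [hA.cfc_eq, IsHermitian.cfc, Unitary.conjStarAlgAut_apply]
  rfl

lemma re_trace_conjTranspose_mul_diagonal (D : Matrix m n ℂ) (a : m → ℝ) (b : n → ℝ) :
    (Dᴴ * diagonal (fun i => (a i : ℂ)) * D * diagonal (fun j => (b j : ℂ))).trace.re =
      ∑ i, ∑ j, a i * b j * ‖D i j‖ ^ 2 := by
  rw [Finset.sum_comm, trace, Complex.re_sum]
  refine Finset.sum_congr rfl fun j _ => ?_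
  rw [diag_apply, mul_diagonal, mul_apply, Finset.sum_mul, Complex.re_sum]
  refine Finset.sum_congr rfl fun i _ => ?_
  rw [mul_diagonal, conjTranspose_apply, ← Complex.normSq_eq_norm_sq, Complex.normSq_apply]
  simp
  ring

/-- Trace of `Cᴴ f(A) C g(B)` as a double sum over the eigenvalues of `A` and `B`. -/
lemma re_trace_conjTranspose_mul_cfc_mul_cfc {A : Matrix m m ℂ} {B : Matrix n n ℂ}
    (hA : A.IsHermitian) (hB : B.IsHermitian) (C : Matrix m n ℂ) (f g : ℝ → ℝ) :
    (Cᴴ * cfc f A * C * cfc g B).trace.re =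
      ∑ i, ∑ j, f (hA.eigenvalues i) * g (hB.eigenvalues j) * spectralWeight hA hB C i j := by
  unfold spectralWeight
  rw [← re_trace_conjTranspose_mul_diagonal, cfc_eq_mul_diagonal_mul hA,
    cfc_eq_mul_diagonal_mul hB, ← Matrix.mul_assoc, trace_mul_comm]
  simp only [conjTranspose_mul, conjTranspose_conjTranspose, Matrix.mul_assoc]

lemma re_trace_cfc_mul_cfc {A B : Matrix m m ℂ} (hA : A.IsHermitian) (hB : B.IsHermitian)
    (f g : ℝ → ℝ) :
    (cfc f A * cfc g B).trace.re =
      ∑ i, ∑ j, f (hA.eigenvalues i) * g (hB.eigenvalues j) * spectralWeight hA hB 1 i j := by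
  simpa using re_trace_conjTranspose_mul_cfc_mul_cfc hA hB 1 f g

lemma re_trace_cfc_eq_sum_eigenvalues {A : Matrix m m ℂ} (hA : A.IsHermitian) (f : ℝ → ℝ) :
    (cfc f A).trace.re = ∑ i, f (hA.eigenvalues i) := by
  have hU : (hA.eigenvectorUnitary : Matrix m m ℂ)ᴴ * (hA.eigenvectorUnitary : Matrix m m ℂ) = 1 :=
    Unitary.coe_star_mul_self _
  rw [cfc_eq_mul_diagonal_mul hA, trace_mul_comm, ← Matrix.mul_assoc, hU, Matrix.one_mul,
    trace_diagonal, Complex.re_sum]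
  simp

lemma re_trace_cfc_eq_sum_roots {A : Matrix m m ℂ} (hA : A.IsHermitian) (f : ℝ → ℝ) :
    (cfc f A).trace.re = (A.charpoly.roots.map fun z => f z.re).sum := by
  rw [re_trace_cfc_eq_sum_eigenvalues hA, hA.roots_charpoly_eq_eigenvalues, Multiset.map_map]
  simp [Function.comp_def]

lemma re_trace_cfc_conjTranspose_mul_self (C : Matrix m m ℂ) (f : ℝ → ℝ) :
    (cfc f (Cᴴ * C)).trace.re = (cfc f (C * Cᴴ)).trace.re := by
  rw [re_trace_cfc_eq_sum_roots (isHermitian_conjTranspose_mul_self C),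
    re_trace_cfc_eq_sum_roots (isHermitian_mul_conjTranspose_self C), charpoly_mul_comm]

end SpectralSums

section JointConcavity

variable {m n : Type*} [Fintype m] [DecidableEq m] [Fintype n] [DecidableEq n]

lemma parallel_sum_le {z y t : ℝ} (hz : 0 < z) (hy : 0 < y) (ht : 0 < t) (a b : ℂ) :
    z * y / (z + t * y) * ‖a + b‖ ^ 2 ≤ t⁻¹ * z * ‖a‖ ^ 2 + y * ‖b‖ ^ 2 := by
  have h : ‖a + b‖ ^ 2 ≤ (‖a‖ + ‖b‖) ^ 2 := by gcongr; exact norm_add_le a b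
  calc z * y / (z + t * y) * ‖a + b‖ ^ 2 ≤ z * y / (z + t * y) * (‖a‖ + ‖b‖) ^ 2 := by gcongr
    _ ≤ t⁻¹ * z * ‖a‖ ^ 2 + y * ‖b‖ ^ 2 := by
      rw [div_mul_eq_mul_div, div_le_iff₀ (by positivity)]
      have : (t⁻¹ * z * ‖a‖ ^ 2 + y * ‖b‖ ^ 2) * (z + t * y) - z * y * (‖a‖ + ‖b‖) ^ 2 =
          t⁻¹ * (z * ‖a‖ - t * y * ‖b‖) ^ 2 := by
        field_simp
        ring
      nlinarith [show 0 ≤ t⁻¹ * (z * ‖a‖ - t * y * ‖b‖) ^ 2 by positivity]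

/-- The quadratic form `⟨K, L_Z R_Y (L_Z + t R_Y)⁻¹ K⟩` in terms of spectral data. -/
noncomputable def parallelForm {Z : Matrix m m ℂ} {Y : Matrix n n ℂ} (hZ : Z.PosDef)
    (hY : Y.PosDef) (K : Matrix m n ℂ) (t : ℝ) : ℝ :=
  ∑ i, ∑ j, hZ.isHermitian.eigenvalues i * hY.isHermitian.eigenvalues j /
    (hZ.isHermitian.eigenvalues i + t * hY.isHermitian.eigenvalues j) *
      spectralWeight hZ.isHermitian hY.isHermitian K i j

lemma re_trace_splitting {Z : Matrix m m ℂ} {Y : Matrix n n ℂ} (hZ : Z.IsHermitian)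
    (hY : Y.IsHermitian) (A B : Matrix m n ℂ) (t : ℝ) :
    t⁻¹ * (Aᴴ * Z * A).trace.re + (Bᴴ * B * Y).trace.re =
      ∑ i, ∑ j, (t⁻¹ * hZ.eigenvalues i * spectralWeight hZ hY A i j +
        hY.eigenvalues j * spectralWeight hZ hY B i j) := by
  have h1 := re_trace_conjTranspose_mul_cfc_mul_cfc hZ hY A id (fun _ => 1)
  have h2 := re_trace_conjTranspose_mul_cfc_mul_cfc hZ hY B (fun _ => 1) id
  rw [cfc_id ℝ Z hZ.isSelfAdjoint, cfc_const_one ℝ Y hY.isSelfAdjoint] at h1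
  rw [cfc_id ℝ Y hY.isSelfAdjoint, cfc_const_one ℝ Z hZ.isSelfAdjoint] at h2
  simp only [Matrix.mul_one, id, mul_one, one_mul] at h1 h2
  rw [h1, h2]
  simp only [Finset.sum_add_distrib, Finset.mul_sum, mul_assoc]

lemma parallelForm_le {Z : Matrix m m ℂ} {Y : Matrix n n ℂ} (hZ : Z.PosDef) (hY : Y.PosDef)
    (A B : Matrix m n ℂ) {t : ℝ} (ht : 0 < t) :
    parallelForm hZ hY (A + B) t ≤ t⁻¹ * (Aᴴ * Z * A).trace.re + (Bᴴ * B * Y).trace.re := by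
  rw [re_trace_splitting hZ.isHermitian hY.isHermitian]
  refine Finset.sum_le_sum fun i _ => Finset.sum_le_sum fun j _ => ?_
  unfold spectralWeight
  rw [Matrix.mul_add, Matrix.add_mul, Matrix.add_apply]
  exact parallel_sum_le (hZ.eigenvalues_pos i) (hY.eigenvalues_pos j) ht _ _

lemma exists_splitting_eq_parallelForm {Z : Matrix m m ℂ} {Y : Matrix n n ℂ} (hZ : Z.PosDef)
    (hY : Y.PosDef) (K : Matrix m n ℂ) {t : ℝ} (ht : 0 < t) :
    ∃ A B : Matrix m n ℂ, A + B = K ∧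
      t⁻¹ * (Aᴴ * Z * A).trace.re + (Bᴴ * B * Y).trace.re = parallelForm hZ hY K t := by
  set U := (hZ.isHermitian.eigenvectorUnitary : Matrix m m ℂ) with hU
  set V := (hY.isHermitian.eigenvectorUnitary : Matrix n n ℂ) with hV
  set z := hZ.isHermitian.eigenvalues
  set y := hY.isHermitian.eigenvalues
  have hU1 : Uᴴ * U = 1 := Unitary.coe_star_mul_self hZ.isHermitian.eigenvectorUnitary
  have hU2 : U * Uᴴ = 1 := Unitary.coe_mul_star_self hZ.isHermitian.eigenvectorUnitary
  have hV1 : Vᴴ * V = 1 := Unitary.coe_star_mul_self hY.isHermitian.eigenvectorUnitary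
  have hV2 : V * Vᴴ = 1 := Unitary.coe_mul_star_self hY.isHermitian.eigenvectorUnitary
  have key : ∀ E : Matrix m n ℂ, Uᴴ * (U * E * Vᴴ) * V = E := fun E => by
    rw [Matrix.mul_assoc U, ← Matrix.mul_assoc, hU1, Matrix.one_mul, Matrix.mul_assoc, hV1,
      Matrix.mul_one]
  let A' : Matrix m n ℂ := of fun i j => ((t * y j / (z i + t * y j) : ℝ) : ℂ) * (Uᴴ * K * V) i j
  let B' : Matrix m n ℂ := of fun i j => ((z i / (z i + t * y j) : ℝ) : ℂ) * (Uᴴ * K * V) i j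
  have hz : ∀ i, 0 < z i := hZ.eigenvalues_pos
  have hy : ∀ j, 0 < y j := hY.eigenvalues_pos
  refine ⟨U * A' * Vᴴ, U * B' * Vᴴ, ?_, ?_⟩
  · have hsum : A' + B' = Uᴴ * K * V := by
      ext i j
      have := hz i
      have := hy j
      have h : t * y j / (z i + t * y j) + z i / (z i + t * y j) = 1 := by
        field_simp
        ring
      change ((t * y j / (z i + t * y j) : ℝ) : ℂ) * (Uᴴ * K * V) i j +
        ((z i / (z i + t * y j) : ℝ) : ℂ) * (Uᴴ * K * V) i j = (Uᴴ * K * V) i j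
      rw [← add_mul, ← Complex.ofReal_add, h, Complex.ofReal_one, one_mul]
    rw [← Matrix.add_mul, ← Matrix.mul_add, hsum, Matrix.mul_assoc Uᴴ, ← Matrix.mul_assoc U, hU2,
      Matrix.one_mul, Matrix.mul_assoc, hV2, Matrix.mul_one]
  · rw [re_trace_splitting hZ.isHermitian hY.isHermitian, parallelForm]
    refine Finset.sum_congr rfl fun i _ => Finset.sum_congr rfl fun j _ => ?_
    have := hz i
    have := hy j
    unfold spectralWeight
    rw [← hU, ← hV, key, key]
    change t⁻¹ * z i * ‖((t * y j / (z i + t * y j) : ℝ) : ℂ) * (Uᴴ * K * V) i j‖ ^ 2 +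
      y j * ‖((z i / (z i + t * y j) : ℝ) : ℂ) * (Uᴴ * K * V) i j‖ ^ 2 =
        z i * y j / (z i + t * y j) * ‖(Uᴴ * K * V) i j‖ ^ 2
    rw [norm_mul, norm_mul, Complex.norm_real, Complex.norm_real,
      Real.norm_of_nonneg (by positivity), Real.norm_of_nonneg (by positivity)]
    field_simp
    ring

lemma parallelForm_concave {Z₀ Z₁ : Matrix m m ℂ} {Y₀ Y₁ : Matrix n n ℂ} (hZ₀ : Z₀.PosDef)
    (hZ₁ : Z₁.PosDef) (hY₀ : Y₀.PosDef) (hY₁ : Y₁.PosDef) (K : Matrix m n ℂ) {t l : ℝ}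
    (ht : 0 < t) (hl0 : 0 ≤ l) (hl1 : l ≤ 1) :
    l * parallelForm hZ₀ hY₀ K t + (1 - l) * parallelForm hZ₁ hY₁ K t ≤
      parallelForm (posDef_convexCombination hZ₀ hZ₁ hl0 hl1)
        (posDef_convexCombination hY₀ hY₁ hl0 hl1) K t := by
  obtain ⟨A, B, rfl, h⟩ := exists_splitting_eq_parallelForm
    (posDef_convexCombination hZ₀ hZ₁ hl0 hl1) (posDef_convexCombination hY₀ hY₁ hl0 hl1) K ht
  have hY := re_trace_mul_convexCombination_mul l (Bᴴ * B) Y₀ Y₁ 1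
  simp only [Matrix.mul_one] at hY
  rw [← h, re_trace_mul_convexCombination_mul, hY]
  have h0 := mul_le_mul_of_nonneg_left (parallelForm_le hZ₀ hY₀ A B ht) hl0
  have h1 := mul_le_mul_of_nonneg_left (parallelForm_le hZ₁ hY₁ A B ht) (sub_nonneg.2 hl1)
  linarith

lemma rpow_mul_rpow_one_sub_eq_integral {p z y : ℝ} (hp : p ∈ Set.Ioo (0 : ℝ) 1) (hz : 0 < z)
    (hy : 0 < y) :
    z ^ p * y ^ (1 - p) = (∫ t in Set.Ioi 0, Real.rpowIntegrand₀₁ p t 1)⁻¹ *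
      ∫ t in Set.Ioi 0, y * Real.rpowIntegrand₀₁ p t (z / y) := by
  rw [MeasureTheory.integral_const_mul, mul_left_comm,
    ← Real.rpow_eq_const_mul_integral hp (by positivity), Real.div_rpow hz.le hy.le,
    Real.rpow_sub hy, Real.rpow_one]
  ring

lemma mul_rpowIntegrand₀₁_div {p t z y : ℝ} (hp : p ∈ Set.Ioo (0 : ℝ) 1) (ht : 0 < t)
    (hz : 0 < z) (hy : 0 < y) :
    y * Real.rpowIntegrand₀₁ p t (z / y) = t ^ (p - 1) * (z * y / (z + t * y)) := by
  rw [Real.rpowIntegrand₀₁_eq_pow_div hp ht.le (by positivity)]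
  field_simp
  ring

/-- Integral representation of `(Z, Y) ↦ Tr[Kᴴ Z^p K Y^(1-p)]`. -/
lemma re_trace_rpow_eq_integral {Z : Matrix m m ℂ} {Y : Matrix n n ℂ} (hZ : Z.PosDef)
    (hY : Y.PosDef) (K : Matrix m n ℂ) {p : ℝ} (hp : p ∈ Set.Ioo (0 : ℝ) 1) :
    MeasureTheory.IntegrableOn (fun t => t ^ (p - 1) * parallelForm hZ hY K t) (Set.Ioi 0) ∧
    (Kᴴ * cfc (fun x : ℝ => x ^ p) Z * K * cfc (fun x : ℝ => x ^ (1 - p)) Y).trace.re =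
      (∫ t in Set.Ioi 0, Real.rpowIntegrand₀₁ p t 1)⁻¹ *
        ∫ t in Set.Ioi 0, t ^ (p - 1) * parallelForm hZ hY K t := by
  set z := hZ.isHermitian.eigenvalues with hz_def
  set y := hY.isHermitian.eigenvalues with hy_def
  have hz : ∀ i, 0 < z i := hZ.eigenvalues_pos
  have hy : ∀ j, 0 < y j := hY.eigenvalues_pos
  set w := spectralWeight hZ.isHermitian hY.isHermitian K with hw_def
  have heq : Set.EqOn (fun t => t ^ (p - 1) * parallelForm hZ hY K t)
      (fun t => ∑ i, ∑ j, y j * Real.rpowIntegrand₀₁ p t (z i / y j) * w i j) (Set.Ioi 0) := by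
    intro t ht
    simp only [parallelForm, Finset.mul_sum]
    refine Finset.sum_congr rfl fun i _ => Finset.sum_congr rfl fun j _ => ?_
    rw [mul_rpowIntegrand₀₁_div hp ht (hz i) (hy j), mul_assoc]
  have hint : ∀ i j, MeasureTheory.IntegrableOn
      (fun t => y j * Real.rpowIntegrand₀₁ p t (z i / y j) * w i j) (Set.Ioi 0) := fun i j =>
    ((Real.integrableOn_rpowIntegrand₀₁_Ioi hp (div_pos (hz i) (hy j)).le).const_mul _).mul_const _
  refine ⟨?_, ?_⟩
  · rw [MeasureTheory.integrableOn_congr_fun heq measurableSet_Ioi]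
    exact MeasureTheory.integrable_finsetSum _ fun i _ =>
      MeasureTheory.integrable_finsetSum _ fun j _ => hint i j
  · rw [re_trace_conjTranspose_mul_cfc_mul_cfc hZ.isHermitian hY.isHermitian,
      MeasureTheory.setIntegral_congr_fun measurableSet_Ioi heq,
      MeasureTheory.integral_finsetSum _ fun i _ =>
        MeasureTheory.integrable_finsetSum _ fun j _ => hint i j, Finset.mul_sum]
    refine Finset.sum_congr rfl fun i _ => ?_
    rw [MeasureTheory.integral_finsetSum _ fun j _ => hint i j, Finset.mul_sum]
    refine Finset.sum_congr rfl fun j _ => ?_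
    rw [MeasureTheory.integral_mul_const, ← mul_assoc,
      ← rpow_mul_rpow_one_sub_eq_integral hp (hz i) (hy j)]

/-- **Lieb's concavity theorem** for positive definite matrices. -/
theorem lieb_concavity {Z₀ Z₁ : Matrix m m ℂ} {Y₀ Y₁ : Matrix n n ℂ} (hZ₀ : Z₀.PosDef)
    (hZ₁ : Z₁.PosDef) (hY₀ : Y₀.PosDef) (hY₁ : Y₁.PosDef) (K : Matrix m n ℂ) {p l : ℝ}
    (hp : p ∈ Set.Ioc (0 : ℝ) 1) (hl0 : 0 ≤ l) (hl1 : l ≤ 1) :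
    l * (Kᴴ * cfc (fun x : ℝ => x ^ p) Z₀ * K * cfc (fun x : ℝ => x ^ (1 - p)) Y₀).trace.re +
      (1 - l) *
        (Kᴴ * cfc (fun x : ℝ => x ^ p) Z₁ * K * cfc (fun x : ℝ => x ^ (1 - p)) Y₁).trace.re ≤
      (Kᴴ * cfc (fun x : ℝ => x ^ p) (l • Z₀ + (1 - l) • Z₁) * K *
        cfc (fun x : ℝ => x ^ (1 - p)) (l • Y₀ + (1 - l) • Y₁)).trace.re := by
  have hZ := posDef_convexCombination hZ₀ hZ₁ hl0 hl1
  have hY := posDef_convexCombination hY₀ hY₁ hl0 hl1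
  rcases hp.2.eq_or_lt with rfl | hp1
  · simp only [sub_self, Real.rpow_zero, Real.rpow_one]
    rw [cfc_const_one ℝ Y₀ hY₀.isHermitian.isSelfAdjoint,
      cfc_const_one ℝ Y₁ hY₁.isHermitian.isSelfAdjoint,
      cfc_const_one ℝ _ hY.isHermitian.isSelfAdjoint,
      cfc_id' ℝ Z₀ hZ₀.isHermitian.isSelfAdjoint, cfc_id' ℝ Z₁ hZ₁.isHermitian.isSelfAdjoint,
      cfc_id' ℝ _ hZ.isHermitian.isSelfAdjoint]
    simp only [Matrix.mul_one]
    rw [re_trace_mul_convexCombination_mul]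
  · have hp' : p ∈ Set.Ioo (0 : ℝ) 1 := ⟨hp.1, hp1⟩
    obtain ⟨hi₀, h₀⟩ := re_trace_rpow_eq_integral hZ₀ hY₀ K hp'
    obtain ⟨hi₁, h₁⟩ := re_trace_rpow_eq_integral hZ₁ hY₁ K hp'
    obtain ⟨hi, h⟩ := re_trace_rpow_eq_integral hZ hY K hp'
    rw [h₀, h₁, h, mul_left_comm, mul_left_comm (1 - l), ← mul_add,
      ← MeasureTheory.integral_const_mul, ← MeasureTheory.integral_const_mul,
      ← MeasureTheory.integral_add (hi₀.const_mul l) (hi₁.const_mul (1 - l))]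
    refine mul_le_mul_of_nonneg_left ?_
      (inv_nonneg.2 (Real.integral_rpowIntegrand₀₁_one_pos hp').le)
    refine MeasureTheory.setIntegral_mono_on ((hi₀.const_mul l).add (hi₁.const_mul (1 - l))) hi
      measurableSet_Ioi fun t ht => ?_
    rw [mul_left_comm, mul_left_comm (1 - l), ← mul_add]
    exact mul_le_mul_of_nonneg_left (parallelForm_concave hZ₀ hZ₁ hY₀ hY₁ K ht hl0 hl1)
      (Real.rpow_nonneg (le_of_lt ht) _)

end JointConcavity

section MatrixPowers

variable {n k : ℕ}

lemma posDef_mpow {A : Matrix (Fin n) (Fin n) ℂ} (hA : A.PosDef) (a : ℝ) : (mpow A a).PosDef := by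
  rw [mpow, cfc_eq_mul_diagonal_mul hA.isHermitian]
  refine PosDef.mul_mul_conjTranspose_same (PosDef.diagonal fun i => ?_) ?_
  · exact_mod_cast Real.rpow_pos_of_pos (hA.eigenvalues_pos i) a
  · exact vecMul_injective_of_isUnit (Unitary.isUnit_coe)

lemma pos_of_mem_spectrum {A : Matrix (Fin n) (Fin n) ℂ} (hA : A.PosDef) {x : ℝ}
    (hx : x ∈ spectrum ℝ A) : 0 < x := by
  rw [hA.isHermitian.spectrum_real_eq_range_eigenvalues] at hx
  obtain ⟨i, rfl⟩ := hx
  exact hA.eigenvalues_pos i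

lemma mpow_mul_mpow {A : Matrix (Fin n) (Fin n) ℂ} (hA : A.PosDef) (a b : ℝ) :
    mpow A a * mpow A b = mpow A (a + b) := by
  unfold mpow
  rw [← cfc_mul _ _ A (finite_real_spectrum.continuousOn _) (finite_real_spectrum.continuousOn _)]
  exact cfc_congr fun x hx => (Real.rpow_add (pos_of_mem_spectrum hA hx) a b).symm

lemma mpow_mpow {A : Matrix (Fin n) (Fin n) ℂ} (hA : A.PosDef) (a b : ℝ) :
    mpow (mpow A a) b = mpow A (a * b) := by
  unfold mpow
  rw [← cfc_comp _ _ A hA.isHermitian.isSelfAdjoint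
    ((finite_real_spectrum.image _).continuousOn _) (finite_real_spectrum.continuousOn _)]
  exact cfc_congr fun x hx => (Real.rpow_mul (pos_of_mem_spectrum hA hx).le a b).symm

lemma mpow_zero {A : Matrix (Fin n) (Fin n) ℂ} (hA : A.PosDef) : mpow A 0 = 1 := by
  simp only [mpow, Real.rpow_zero]
  exact cfc_const_one ℝ A hA.isHermitian.isSelfAdjoint

lemma mpow_one {A : Matrix (Fin n) (Fin n) ℂ} (hA : A.PosDef) : mpow A 1 = A := by
  simp only [mpow, Real.rpow_one]
  exact cfc_id' ℝ A hA.isHermitian.isSelfAdjoint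

lemma conjTranspose_mpow {A : Matrix (Fin n) (Fin n) ℂ} (hA : A.PosDef) (a : ℝ) :
    (mpow A a)ᴴ = mpow A a :=
  (posDef_mpow hA a).isHermitian

/-- A scalar Young-type inequality transfers to traces of functions of two positive definite
matrices. -/
lemma re_trace_young {A B : Matrix (Fin n) (Fin n) ℂ} (hA : A.PosDef) (hB : B.PosDef)
    {f g F G : ℝ → ℝ} {c q r : ℝ}
    (h : ∀ x y : ℝ, 0 < x → 0 < y → c * (f x * g y) ≤ q * F x + r * G y) :
    c * (cfc f A * cfc g B).trace.re ≤ q * (cfc F A).trace.re + r * (cfc G B).trace.re := by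
  have hF := re_trace_cfc_mul_cfc hA.isHermitian hB.isHermitian F (fun _ => 1)
  have hG := re_trace_cfc_mul_cfc hA.isHermitian hB.isHermitian (fun _ => 1) G
  rw [cfc_const_one ℝ B hB.isHermitian.isSelfAdjoint, Matrix.mul_one] at hF
  rw [cfc_const_one ℝ A hA.isHermitian.isSelfAdjoint, Matrix.one_mul] at hG
  rw [re_trace_cfc_mul_cfc hA.isHermitian hB.isHermitian, hF, hG]
  simp only [Finset.mul_sum, ← Finset.sum_add_distrib]
  refine Finset.sum_le_sum fun i _ => Finset.sum_le_sum fun j _ => ?_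
  have := mul_le_mul_of_nonneg_right (h _ _ (hA.eigenvalues_pos i) (hB.eigenvalues_pos j))
    (spectralWeight_nonneg hA.isHermitian hB.isHermitian 1 i j)
  linarith

lemma re_trace_mul_mpow_one_sub_le {A B : Matrix (Fin n) (Fin n) ℂ} (hA : A.PosDef)
    (hB : B.PosDef) {p : ℝ} (hp : p ∈ Set.Ioc (0 : ℝ) 1) :
    (A * mpow B (1 - p)).trace.re ≤
      p * (mpow A (1 / p)).trace.re + (1 - p) * B.trace.re := by
  have h := re_trace_young hA hB (f := fun x => x ^ (1 : ℝ)) (g := fun y => y ^ (1 - p))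
    (F := fun x => x ^ (1 / p)) (G := fun y => y ^ (1 : ℝ)) (c := 1) (q := p) (r := 1 - p)
    fun x y hx hy => by
      have := Real.geom_mean_le_arith_mean2_weighted hp.1.le (sub_nonneg.2 hp.2)
        (Real.rpow_nonneg hx.le (1 / p)) hy.le (by ring)
      rwa [← Real.rpow_mul hx.le, one_div_mul_cancel hp.1.ne', ← one_mul (_ * _),
        ← Real.rpow_one y, ← Real.rpow_mul hy.le, one_mul (1 - p)] at this
  change 1 * (mpow A 1 * mpow B (1 - p)).trace.re ≤
    p * (mpow A (1 / p)).trace.re + (1 - p) * (mpow B 1).trace.re at h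
  rwa [mpow_one hA, mpow_one hB, one_mul] at h

lemma re_trace_mpow_le {A B : Matrix (Fin n) (Fin n) ℂ} (hA : A.PosDef) (hB : B.PosDef) {α : ℝ}
    (hα : α ∈ Set.Ioo (0 : ℝ) 1) :
    (mpow A α).trace.re ≤
      α * (A * mpow B (-1)).trace.re + (1 - α) * (mpow B (α / (1 - α))).trace.re := by
  have h := re_trace_young hA hB (f := fun x => x ^ (1 : ℝ)) (g := fun y => y ^ (-1 : ℝ))
    (F := fun x => x ^ α) (G := fun y => y ^ (α / (1 - α))) (c := -α) (q := -1) (r := 1 - α)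
    fun x y hx hy => by
      have h1 : 0 < 1 - α := sub_pos.2 hα.2
      have := Real.geom_mean_le_arith_mean2_weighted hα.1.le h1.le
        (mul_pos hx (Real.rpow_pos_of_pos hy (-1))).le
        (Real.rpow_nonneg hy.le (α / (1 - α))) (by ring)
      rw [Real.mul_rpow hx.le (Real.rpow_nonneg hy.le _), ← Real.rpow_mul hy.le,
        ← Real.rpow_mul hy.le, div_mul_cancel₀ _ h1.ne', mul_assoc, ← Real.rpow_add hy,
        neg_one_mul, neg_add_cancel, Real.rpow_zero, mul_one] at this
      rw [Real.rpow_one]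
      linarith
  change -α * (mpow A 1 * mpow B (-1)).trace.re ≤
    -1 * (mpow A α).trace.re + (1 - α) * (mpow B (α / (1 - α))).trace.re at h
  rw [mpow_one hA] at h
  linarith

/-- **Epstein's concavity theorem**: `Z ↦ Tr[(Lᴴ Z^p L)^(1/p)]` is concave. -/
theorem epstein_concavity {L : Matrix (Fin n) (Fin k) ℂ} (hL : Function.Injective L.mulVec)
    {Z₀ Z₁ : Matrix (Fin n) (Fin n) ℂ} (hZ₀ : Z₀.PosDef) (hZ₁ : Z₁.PosDef) {p l : ℝ}
    (hp : p ∈ Set.Ioc (0 : ℝ) 1) (hl0 : 0 ≤ l) (hl1 : l ≤ 1) :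
    l * (mpow (Lᴴ * mpow Z₀ p * L) (1 / p)).trace.re +
      (1 - l) * (mpow (Lᴴ * mpow Z₁ p * L) (1 / p)).trace.re ≤
      (mpow (Lᴴ * mpow (l • Z₀ + (1 - l) • Z₁) p * L) (1 / p)).trace.re := by
  have hX : ∀ {Z : Matrix (Fin n) (Fin n) ℂ}, Z.PosDef → (Lᴴ * mpow Z p * L).PosDef :=
    fun hZ => (posDef_mpow hZ p).conjTranspose_mul_mul_same hL
  have hself : ∀ {X : Matrix (Fin k) (Fin k) ℂ}, X.PosDef →
      X * mpow (mpow X (1 / p)) (1 - p) = mpow X (1 / p) := fun {X} hX => by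
    conv_lhs => rw [mpow_mpow hX]; enter [1]; rw [← mpow_one hX]
    rw [mpow_mul_mpow hX]
    congr 1
    have := hp.1.ne'
    field_simp
    ring
  have hlieb := lieb_concavity hZ₀ hZ₁ (posDef_mpow (hX hZ₀) (1 / p))
    (posDef_mpow (hX hZ₁) (1 / p)) L hp hl0 hl1
  have hyoung := re_trace_mul_mpow_one_sub_le (hX (posDef_convexCombination hZ₀ hZ₁ hl0 hl1))
    (posDef_convexCombination (posDef_mpow (hX hZ₀) (1 / p)) (posDef_mpow (hX hZ₁) (1 / p))
      hl0 hl1) hp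
  change l * (Lᴴ * mpow Z₀ p * L * mpow (mpow (Lᴴ * mpow Z₀ p * L) (1 / p)) (1 - p)).trace.re +
    (1 - l) * (Lᴴ * mpow Z₁ p * L * mpow (mpow (Lᴴ * mpow Z₁ p * L) (1 / p)) (1 - p)).trace.re ≤
    (Lᴴ * mpow (l • Z₀ + (1 - l) • Z₁) p * L * mpow (l • mpow (Lᴴ * mpow Z₀ p * L) (1 / p) +
      (1 - l) • mpow (Lᴴ * mpow Z₁ p * L) (1 / p)) (1 - p)).trace.re at hlieb
  rw [hself (hX hZ₀), hself (hX hZ₁)] at hlieb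
  have htr := re_trace_mul_convexCombination_mul l (1 : Matrix (Fin k) (Fin k) ℂ)
    (mpow (Lᴴ * mpow Z₀ p * L) (1 / p)) (mpow (Lᴴ * mpow Z₁ p * L) (1 / p)) 1
  simp only [Matrix.one_mul, Matrix.mul_one] at htr
  rw [htr] at hyoung
  exact le_of_mul_le_mul_left (by linarith) hp.1

/-- Variational upper bound for `Tr[(G^{1/2} R W Rᴴ G^{1/2})^α]`, affine in `G`. -/
lemma re_trace_mpow_sandwich_le {G W R : Matrix (Fin k) (Fin k) ℂ} (hG : G.PosDef)
    (hW : W.PosDef) (hR : IsUnit R) {α : ℝ} (hα : α ∈ Set.Ioo (0 : ℝ) 1) :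
    (mpow (mpow G (1 / 2) * (R * W * Rᴴ) * mpow G (1 / 2)) α).trace.re ≤
      α * (Rᴴ * G * R).trace.re + (1 - α) * (mpow W (α / (1 - α))).trace.re := by
  set C := mpow W (1 / 2) * Rᴴ * mpow G (1 / 2) with hC
  have hhalf : ∀ {A : Matrix (Fin k) (Fin k) ℂ}, A.PosDef → mpow A (1 / 2) * mpow A (1 / 2) = A :=
    fun hA => by rw [mpow_mul_mpow hA, add_halves, mpow_one hA]
  have hCt : Cᴴ = mpow G (1 / 2) * R * mpow W (1 / 2) := by
    simp only [hC, conjTranspose_mul, conjTranspose_conjTranspose, conjTranspose_mpow hG,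
      conjTranspose_mpow hW, Matrix.mul_assoc]
  have h1 : mpow G (1 / 2) * (R * W * Rᴴ) * mpow G (1 / 2) = Cᴴ * C := by
    conv_lhs => rw [← hhalf hW]
    rw [hCt, hC]
    simp only [Matrix.mul_assoc]
  have h2 : C * Cᴴ = mpow W (1 / 2) * (Rᴴ * G * R) * mpow W (1 / 2) := by
    conv_rhs => rw [← hhalf hG]
    rw [hCt, hC]
    simp only [Matrix.mul_assoc]
  have hRGR : (Rᴴ * G * R).PosDef := hG.conjTranspose_mul_mul_same (mulVec_injective_of_isUnit hR)
  have hN : (C * Cᴴ).PosDef := by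
    have := hRGR.conjTranspose_mul_mul_same
      (mulVec_injective_of_isUnit (posDef_mpow hW (1 / 2)).isUnit)
    rwa [conjTranspose_mpow hW, ← h2] at this
  have h3 : (C * Cᴴ * mpow W (-1)).trace = (Rᴴ * G * R).trace := by
    rw [h2, Matrix.mul_assoc, Matrix.mul_assoc, trace_mul_comm, Matrix.mul_assoc,
      mpow_mul_mpow hW, mpow_mul_mpow hW]
    norm_num [mpow_zero hW]
  have h4 := re_trace_mpow_le hN hW hα
  rwa [h3, mpow, ← re_trace_cfc_conjTranspose_mul_self, ← h1] at h4

end MatrixPowers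

/-- For an isometry `S` and `α ∈ [1/2, 1)`, the map `(G, Z) ↦ Ψ_{α,S}(G, Z)` is jointly
concave on pairs of positive definite Hermitian matrices. -/
theorem stmt8 {n k : ℕ} (S : Matrix (Fin n) (Fin k) ℂ) (hS : Sᴴ * S = 1)
    (α : ℝ) (hα : α ∈ Set.Ico (1 / 2 : ℝ) 1)
    (G₀ G₁ : Matrix (Fin k) (Fin k) ℂ) (Z₀ Z₁ : Matrix (Fin n) (Fin n) ℂ)
    (hG₀ : G₀.PosDef) (hG₁ : G₁.PosDef) (hZ₀ : Z₀.PosDef) (hZ₁ : Z₁.PosDef)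
    (l : ℝ) (hl0 : 0 ≤ l) (hl1 : l ≤ 1) :
    l * PsiS α S G₀ Z₀ + (1 - l) * PsiS α S G₁ Z₁
      ≤ PsiS α S (l • G₀ + (1 - l) • G₁) (l • Z₀ + (1 - l) • Z₁) := by
  have hα0 : 0 < α := by linarith [hα.1]
  have hα1 : 0 < 1 - α := by linarith [hα.2]
  have hp : (1 - α) / α ∈ Set.Ioc (0 : ℝ) 1 :=
    ⟨by positivity, by rw [div_le_one hα0]; linarith [hα.1]⟩
  have hG := posDef_convexCombination hG₀ hG₁ hl0 hl1
  have hZ := posDef_convexCombination hZ₀ hZ₁ hl0 hl1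
  have htr := fun C D : Matrix (Fin k) (Fin k) ℂ =>
    re_trace_mul_convexCombination_mul l C G₀ G₁ D
  set G := l • G₀ + (1 - l) • G₁
  set Z := l • Z₀ + (1 - l) • Z₁
  set p := (1 - α) / α with hp_def
  have hpinv : α / (1 - α) = 1 / p := by rw [hp_def, one_div_div]
  have hSinj : Function.Injective S.mulVec := fun v w hvw => by
    simpa [hS] using congrArg (Sᴴ *ᵥ ·) hvw
  set M := mpow G (1 / 2) * (Sᴴ * mpow Z p * S) * mpow G (1 / 2) with hM_def
  have hM : M.PosDef := by
    have := ((posDef_mpow hZ p).conjTranspose_mul_mul_same hSinj).conjTranspose_mul_mul_same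
      (mulVec_injective_of_isUnit (posDef_mpow hG (1 / 2)).isUnit)
    rwa [conjTranspose_mpow hG] at this
  have hPsi : ∀ G' Z', PsiS α S G' Z' =
      (mpow (mpow G' (1 / 2) * (Sᴴ * mpow Z' p * S) * mpow G' (1 / 2)) α).trace.re := fun G' Z' => by
    simp only [PsiS, ← hp_def, Matrix.mul_assoc]
  -- The optimal factor in the variational bound at `(G, Z)` and its inverse.
  set R := mpow G (-(1 / 2)) * mpow M (α / 2) with hR_def
  set T := mpow M (-(α / 2)) * mpow G (1 / 2) with hT_def
  have hGi : mpow G (-(1 / 2)) * mpow G (1 / 2) = 1 := by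
    rw [mpow_mul_mpow hG, neg_add_cancel, mpow_zero hG]
  have hMi : mpow M (α / 2) * mpow M (-(α / 2)) = 1 := by
    rw [mpow_mul_mpow hM, add_neg_cancel, mpow_zero hM]
  have hRT : R * T = 1 := by
    rw [hR_def, hT_def, Matrix.mul_assoc, ← Matrix.mul_assoc (mpow M _), hMi, Matrix.one_mul, hGi]
  have hR : IsUnit R := IsUnit.of_mul_eq_one T hRT
  have hTR : Tᴴ * Rᴴ = 1 := by rw [← conjTranspose_mul, hRT, conjTranspose_one]
  have hTu : IsUnit Tᴴ := IsUnit.of_mul_eq_one Rᴴ hTR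
  set L := S * Tᴴ with hL_def
  have hL : Function.Injective L.mulVec := fun v w hvw => by
    simp only [hL_def, ← mulVec_mulVec] at hvw
    exact mulVec_injective_of_isUnit hTu (hSinj hvw)
  have hLW : ∀ Z' : Matrix (Fin n) (Fin n) ℂ,
      Lᴴ * mpow Z' p * L = T * (Sᴴ * mpow Z' p * S) * Tᴴ := fun Z' => by
    simp only [hL_def, conjTranspose_mul, conjTranspose_conjTranspose, Matrix.mul_assoc]
  have hbound : ∀ {G' : Matrix (Fin k) (Fin k) ℂ} {Z' : Matrix (Fin n) (Fin n) ℂ}, G'.PosDef →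
      Z'.PosDef → PsiS α S G' Z' ≤ α * (Rᴴ * G' * R).trace.re +
        (1 - α) * (mpow (Lᴴ * mpow Z' p * L) (1 / p)).trace.re := fun {G' Z'} hG' hZ' => by
    have h := re_trace_mpow_sandwich_le hG'
      ((posDef_mpow hZ' p).conjTranspose_mul_mul_same hL) hR ⟨hα0, hα.2⟩
    have hX : R * (Lᴴ * mpow Z' p * L) * Rᴴ = Sᴴ * mpow Z' p * S := by
      rw [hLW, Matrix.mul_assoc T, ← Matrix.mul_assoc R, hRT, Matrix.one_mul, Matrix.mul_assoc,
        hTR, Matrix.mul_one]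
    rwa [hX, hpinv, ← hPsi] at h
  have hRGR : Rᴴ * G * R = mpow M α := by
    have h1 : mpow G (-(1 / 2)) * G * mpow G (-(1 / 2)) = 1 := by
      conv_lhs => enter [1, 2]; rw [← mpow_one hG]
      rw [mpow_mul_mpow hG, mpow_mul_mpow hG]
      norm_num [mpow_zero hG]
    calc Rᴴ * G * R = mpow M (α / 2) * (mpow G (-(1 / 2)) * G * mpow G (-(1 / 2))) *
          mpow M (α / 2) := by
          simp only [hR_def, conjTranspose_mul, conjTranspose_mpow hG, conjTranspose_mpow hM,
            Matrix.mul_assoc]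
      _ = mpow M α := by rw [h1, Matrix.mul_one, mpow_mul_mpow hM, add_halves]
  have hLZL : mpow (Lᴴ * mpow Z p * L) (1 / p) = mpow M α := by
    have h1 : Lᴴ * mpow Z p * L = mpow M (-(α / 2)) * M * mpow M (-(α / 2)) := by
      rw [hLW, hT_def, conjTranspose_mul, conjTranspose_mpow hG, conjTranspose_mpow hM]
      conv_rhs => enter [1, 2]; rw [hM_def]
      simp only [Matrix.mul_assoc]
    have h2 : Lᴴ * mpow Z p * L = mpow M (1 - α) := by
      rw [h1]
      conv_lhs => enter [1, 2]; rw [← mpow_one hM]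
      rw [mpow_mul_mpow hM, mpow_mul_mpow hM]
      congr 1
      ring
    rw [h2, mpow_mpow hM, ← hpinv, mul_div_cancel₀ _ hα1.ne']
  have hepstein := epstein_concavity hL hZ₀ hZ₁ hp hl0 hl1
  change _ ≤ (mpow (Lᴴ * mpow Z p * L) (1 / p)).trace.re at hepstein
  rw [hLZL] at hepstein
  have htrR := htr Rᴴ R
  rw [hRGR] at htrR
  have h0 := mul_le_mul_of_nonneg_left (hbound hG₀ hZ₀) hl0
  have h1 := mul_le_mul_of_nonneg_left (hbound hG₁ hZ₁) (sub_nonneg.2 hl1)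
  have h2 := mul_le_mul_of_nonneg_left hepstein hα1.le
  rw [hPsi G Z]
  change _ ≤ (mpow M α).trace.re
  linear_combination h0 + h1 + h2 - α * htrR
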